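/- Let R be an integral domain, Y a Stone space, f : Y → Σ(R) continuous with respect to the Zariski topology, and A = {a ∈ LocallyConstant(Y, R) : a(y) ∈ f(y) for all y ∈ Y} the patch algebra of the patch bundle f. Then A is a Rickart ring: for every a ∈ A there exists an idempotent e ∈ A such that the annihilator of a in A, {b ∈ A : a·b = 0}, equals the principal ideal of A generated by e. -/

import Mathlib

/-- The Zariski topology on the set of subrings of a commutative ring `R`,
generated by the sets `{S | r ∈ S}` for `r ∈ R`. -/
instance zariskiTopology (R : Type*) [CommRing R] : TopologicalSpace (Subring R) :=
  TopologicalSpace.generateFrom {U : Set (Subring R) | ∃ r : R, U = {S : Subring R | r ∈ S}}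

/-- The patch algebra of a family `f` of subrings of `R` indexed by a topological
space `Y`: the subring of `LocallyConstant Y R` consisting of the locally constant
functions `a` with `a y ∈ f y` for all `y`. -/
def patchAlgebra (Y : Type*) [TopologicalSpace Y] (R : Type*) [CommRing R]
    (f : Y → Subring R) : Subring (LocallyConstant Y R) where
  carrier := {a : LocallyConstant Y R | ∀ y : Y, a y ∈ f y}
  zero_mem' := fun y => by simpa using zero_mem (f y)
  one_mem' := fun y => by simpa using one_mem (f y)
  add_mem' := fun {a b} ha hb y => by simpa using add_mem (ha y) (hb y)
  mul_mem' := fun {a b} ha hb y => by simpa using mul_mem (ha y) (hb y)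
  neg_mem' := fun {a} ha y => by simpa using neg_mem (ha y)

/-- Let `R` be an integral domain, `Y` a Stone space, `f : Y → Σ(R)` continuous for the
Zariski topology, and `A` the patch algebra of the patch bundle `f`.  Then `A` is a
Rickart ring: the annihilator of each element of `A` is the principal ideal generated
by an idempotent. -/
theorem patchAlgebra_isRickart (R : Type*) [CommRing R] [IsDomain R]
    (Y : Type*) [TopologicalSpace Y] [CompactSpace Y] [T2Space Y]
    [TotallyDisconnectedSpace Y] (f : Y → Subring R) (hf : Continuous f) :
    ∀ a : patchAlgebra Y R f, ∃ e : patchAlgebra Y R f, IsIdempotentElem e ∧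
      {b : patchAlgebra Y R f | a * b = 0} = (Ideal.span {e} : Set (patchAlgebra Y R f)) := by
  classical
  intro a
  let g : R → R := fun r => if r = 0 then 1 else 0
  have hmem : (a : LocallyConstant Y R).map g ∈ patchAlgebra Y R f := by
    intro y
    rw [LocallyConstant.map_apply]
    simp only [Function.comp, g]
    split_ifs
    · exact one_mem _
    · exact zero_mem _
  refine ⟨⟨_, hmem⟩, ?_, ?_⟩
  · apply Subtype.ext
    ext y
    simp [g]
  · ext b
    simp only [Set.mem_setOf_eq, SetLike.mem_coe, Ideal.mem_span_singleton]
    constructor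
    · intro h
      refine ⟨b, Subtype.ext (LocallyConstant.ext fun y => ?_)⟩
      have h1 : (a : LocallyConstant Y R) y * (b : LocallyConstant Y R) y = 0 := by
        have := congrArg (fun c : patchAlgebra Y R f => (c : LocallyConstant Y R) y) h
        simpa using this
      rcases mul_eq_zero.mp h1 with h2 | h2 <;> simp [g, h2]
    · rintro ⟨c, rfl⟩
      apply Subtype.ext
      ext y
      by_cases h : (a : LocallyConstant Y R) y = 0 <;> simp [g, h]
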